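/- Global route stabilization within the eccentricity of the target (Corollary 'next'): let D ∈ ℕ be an upper bound on edist_G(i,t) over all vertices i connected to t. For every initial estimate d₀ : V → ℕ∞ with d₀(t) = 0 and every k ≥ D, the k-fold iterate satisfies F^[k](d₀)(i) = edist_G(i,t) simultaneously for every vertex i connected to t. -/

import Mathlib

open SimpleGraph

/-- The synchronous distance-vector (Bellman–Ford) routing update toward target `t`. -/
noncomputable def routeUpdate {V : Type*} [Fintype V] [DecidableEq V] (G : SimpleGraph V) (t : V)
    (d : V → ℕ∞) : V → ℕ∞ :=
  fun i => if i = t then 0 else 1 + ⨅ j ∈ G.neighborSet i, d j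

theorem iter_target {V : Type*} [Fintype V] [DecidableEq V] (G : SimpleGraph V) (t : V)
    (d₀ : V → ℕ∞) (h₀ : d₀ t = 0) (k : ℕ) : (routeUpdate G t)^[k] d₀ t = 0 := by
  cases k with
  | zero => simpa using h₀
  | succ k => rw [Function.iterate_succ_apply']; simp [routeUpdate]

theorem iter_upper {V : Type*} [Fintype V] [DecidableEq V] (G : SimpleGraph V) (t : V)
    (d₀ : V → ℕ∞) (h₀ : d₀ t = 0) {i : V} (p : G.Walk i t) :
    ∀ k : ℕ, p.length ≤ k → (routeUpdate G t)^[k] d₀ i ≤ (p.length : ℕ∞) := by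
  induction p with
  | nil => intro k _; rw [iter_target G _ d₀ h₀ k]; simp
  | @cons u v w h q ih =>
    intro k hk
    rw [SimpleGraph.Walk.length_cons] at hk ⊢
    obtain ⟨k, rfl⟩ : ∃ m, k = m + 1 := ⟨k - 1, by omega⟩
    rw [Function.iterate_succ_apply', routeUpdate]
    split_ifs with hu
    · simp
    · rw [Nat.cast_add, Nat.cast_one, add_comm]
      gcongr
      exact (iInf₂_le v h).trans (ih h₀ k (by omega))

theorem iter_lower {V : Type*} [Fintype V] [DecidableEq V] (G : SimpleGraph V) (t : V)
    (d₀ : V → ℕ∞) (k : ℕ) :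
    ∀ i : V, min (G.edist i t) (k : ℕ∞) ≤ (routeUpdate G t)^[k] d₀ i := by
  induction k with
  | zero => intro i; simp
  | succ k ih =>
    intro i
    rw [Function.iterate_succ_apply', routeUpdate]
    split_ifs with hu
    · subst hu; simp
    · have key : min (G.edist i t) ((k + 1 : ℕ) : ℕ∞) - 1 ≤
          ⨅ j ∈ G.neighborSet i, (routeUpdate G t)^[k] d₀ j := by
        refine le_iInf₂ fun j hj => le_trans ?_ (ih j)
        have h1 : G.edist i j = 1 := SimpleGraph.edist_eq_one_iff_adj.mpr hj
        have h2 : G.edist i t ≤ 1 + G.edist j t := h1 ▸ G.edist_triangle (u := i) (v := j) (w := t)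
        rw [tsub_le_iff_left]
        refine le_min ?_ ?_ |>.trans (min_add_add_left 1 (G.edist j t) (k : ℕ∞)).le
        · exact (min_le_left _ _).trans h2
        · exact (min_le_right _ _).trans (by push_cast; rw [add_comm])
      exact tsub_le_iff_left.mp key

theorem stmt_4 {V : Type*} [Fintype V] [DecidableEq V] (G : SimpleGraph V) (t : V)
    (D : ℕ) (hD : ∀ i : V, G.Reachable i t → G.edist i t ≤ (D : ℕ∞))
    (d₀ : V → ℕ∞) (h₀ : d₀ t = 0) (k : ℕ) (hk : D ≤ k) :
    ∀ i : V, G.Reachable i t → (routeUpdate G t)^[k] d₀ i = G.edist i t := by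
  intro i hi
  apply le_antisymm
  · obtain ⟨p, hp⟩ := hi.exists_walk_length_eq_edist
    rw [← hp]
    refine iter_upper G t d₀ h₀ p k ?_
    have := hD i hi
    rw [← hp] at this
    exact (Nat.cast_le.mp this).trans hk
  · have h := iter_lower G t d₀ k i
    rwa [min_eq_left ((hD i hi).trans (Nat.cast_le.mpr hk))] at h
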